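/- If the function α ↦ c(0,α) − c(1,α) is not constant on A, then a̲ < ā, i.e. inf_{z∈ℝ}(H⁰(z) − H¹(z)) < sup_{z∈ℝ}(H⁰(z) − H¹(z)) holds strictly. -/

import Mathlib

/-- The Hamiltonian `H^θ(z) := sup_{α ∈ A} (z·α − c(θ,α))`. -/
noncomputable def Ham (a_min a_max : ℝ) (c : Fin 2 → ℝ → ℝ) (θ : Fin 2) (z : ℝ) : ℝ :=
  sSup ((fun α => z * α - c θ α) '' Set.Icc a_min a_max)

theorem tangent_aux (a b ρ : ℝ) (hρ : 0 < ρ) (f f' f'' : ℝ → ℝ)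
    (h1 : ∀ x ∈ Set.Icc a b, HasDerivAt f (f' x) x)
    (h2 : ∀ x ∈ Set.Icc a b, HasDerivAt f' (f'' x) x)
    (h3 : ∀ x ∈ Set.Icc a b, ρ ≤ f'' x) (x y : ℝ) (hx : x ∈ Set.Icc a b)
    (hy : y ∈ Set.Icc a b) : f x + f' x * (y - x) ≤ f y := by
  have hconv : ConvexOn ℝ (Set.Icc a b) f := by
    refine convexOn_of_hasDerivWithinAt2_nonneg (f' := f') (f'' := f'') (convex_Icc a b)
      (fun x hx => (h1 x hx).continuousAt.continuousWithinAt)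
      (fun x hx => (h1 x (interior_subset hx)).hasDerivWithinAt)
      (fun x hx => (h2 x (interior_subset hx)).hasDerivWithinAt)
      (fun x hx => hρ.le.trans (h3 x (interior_subset hx)))
  rcases lt_trichotomy x y with h | h | h
  · have := hconv.le_slope_of_hasDerivAt hx hy h (h1 x hx)
    rw [slope_def_field, le_div_iff₀ (by linarith)] at this
    linarith
  · subst h; simp
  · have := hconv.slope_le_of_hasDerivAt hy hx h (h1 x hx)
    rw [slope_def_field, div_le_iff₀ (by linarith)] at this
    linarith

theorem Ham_bdd_aux (a b : ℝ) (f : ℝ → ℝ) (hf : ContinuousOn f (Set.Icc a b)) (z : ℝ) :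
    BddAbove ((fun α => z * α - f α) '' Set.Icc a b) :=
  (isCompact_Icc.image_of_continuousOn (by fun_prop)).bddAbove

/-- If `α ↦ c(0,α) − c(1,α)` is not constant on `A`, then
`inf_{z∈ℝ}(H⁰(z) − H¹(z)) < sup_{z∈ℝ}(H⁰(z) − H¹(z))` holds strictly. -/
theorem stmt_4
    (a_min a_max ρ N0 : ℝ)
    (hA : a_min < a_max) (hρ : 0 < ρ)
    (c c' c'' : Fin 2 → ℝ → ℝ)
    (hc' : ∀ θ : Fin 2, ∀ α ∈ Set.Icc a_min a_max, HasDerivAt (c θ) (c' θ α) α)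
    (hc'' : ∀ θ : Fin 2, ∀ α ∈ Set.Icc a_min a_max, HasDerivAt (c' θ) (c'' θ α) α)
    (hc''cont : ∀ θ : Fin 2, ContinuousOn (c'' θ) (Set.Icc a_min a_max))
    (hconv : ∀ θ : Fin 2, ∀ α ∈ Set.Icc a_min a_max, ρ ≤ c'' θ α)
    (hN0 : ∀ θ : Fin 2, ∀ α ∈ Set.Icc a_min a_max, |c' θ α| + |α| ≤ N0)
    (hnonconst : ∃ α ∈ Set.Icc a_min a_max, ∃ β ∈ Set.Icc a_min a_max,
      c 0 α - c 1 α ≠ c 0 β - c 1 β) :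
    sInf (Set.range fun z => Ham a_min a_max c 0 z - Ham a_min a_max c 1 z)
      < sSup (Set.range fun z => Ham a_min a_max c 0 z - Ham a_min a_max c 1 z) := by
  have hcont : ∀ θ, ContinuousOn (c θ) (Set.Icc a_min a_max) := fun θ x hx =>
    (hc' θ x hx).continuousAt.continuousWithinAt
  have hne : (Set.Icc a_min a_max).Nonempty := Set.nonempty_Icc.2 hA.le
  have hle : ∀ θ z, ∀ α ∈ Set.Icc a_min a_max, z * α - c θ α ≤ Ham a_min a_max c θ z :=
    fun θ z α hα => le_csSup (Ham_bdd_aux _ _ _ (hcont θ) z) ⟨α, hα, rfl⟩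
  have hub : ∀ θ z M, (∀ α ∈ Set.Icc a_min a_max, z * α - c θ α ≤ M) →
      Ham a_min a_max c θ z ≤ M := by
    intro θ z M h
    refine csSup_le (hne.image _) ?_
    rintro _ ⟨α, hα, rfl⟩
    exact h α hα
  have htan : ∀ θ, ∀ α ∈ Set.Icc a_min a_max,
      Ham a_min a_max c θ (c' θ α) ≤ c' θ α * α - c θ α := by
    intro θ α hα
    refine hub _ _ _ fun β hβ => ?_
    have := tangent_aux a_min a_max ρ hρ _ _ _ (hc' θ) (hc'' θ) (hconv θ) α β hα hβ
    linarith
  obtain ⟨K, hK⟩ := isCompact_Icc.exists_bound_of_continuousOn ((hcont 0).sub (hcont 1))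
  have hK' : ∀ α ∈ Set.Icc a_min a_max, -K ≤ c 0 α - c 1 α ∧ c 0 α - c 1 α ≤ K :=
    fun α hα => abs_le.1 (hK α hα)
  have hba : BddAbove (Set.range fun z => Ham a_min a_max c 0 z - Ham a_min a_max c 1 z) := by
    refine ⟨K, ?_⟩
    rintro _ ⟨z, rfl⟩
    have := hub 0 z (Ham a_min a_max c 1 z + K) fun α hα => by
      linarith [hle 1 z α hα, (hK' α hα).1]
    simp only
    linarith
  have hbb : BddBelow (Set.range fun z => Ham a_min a_max c 0 z - Ham a_min a_max c 1 z) := by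
    refine ⟨-K, ?_⟩
    rintro _ ⟨z, rfl⟩
    have := hub 1 z (Ham a_min a_max c 0 z + K) fun α hα => by
      linarith [hle 0 z α hα, (hK' α hα).2]
    simp only
    linarith
  by_contra hcon
  rw [not_lt] at hcon
  set S := sSup (Set.range fun z => Ham a_min a_max c 0 z - Ham a_min a_max c 1 z)
  have hS1 : ∀ z, Ham a_min a_max c 0 z - Ham a_min a_max c 1 z ≤ S :=
    fun z => le_csSup hba ⟨z, rfl⟩
  have hS2 : ∀ z, S ≤ Ham a_min a_max c 0 z - Ham a_min a_max c 1 z :=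
    fun z => hcon.trans (csInf_le hbb ⟨z, rfl⟩)
  have key : ∀ α ∈ Set.Icc a_min a_max, c 0 α - c 1 α = -S := by
    intro α hα
    apply le_antisymm
    · linarith [htan 0 α hα, hle 1 (c' 0 α) α hα, hS2 (c' 0 α)]
    · linarith [htan 1 α hα, hle 0 (c' 1 α) α hα, hS1 (c' 1 α)]
  obtain ⟨α, hα, β, hβ, h⟩ := hnonconst
  exact h ((key α hα).trans (key β hβ).symm)
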